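/- The fixed point B̄ of the substitution ψ is squarefree: for every k ≥ 0, the finite word ψ^k(a) contains no factor of the form uu with u a nonempty finite word. Equivalently, for all i ≥ 0 and L ≥ 1 there exists 0 ≤ s < L with B̄(i+s) ≠ B̄(i+L+s). -/

import Mathlib

/-- The substitution ψ on the alphabet {a,a',b,c} (encoded as `Fin 4` with
a = 0, a' = 1, b = 2, c = 3): a ↦ aa', a' ↦ bc, b ↦ aa'c, c ↦ b. -/
def psi : Fin 4 → List (Fin 4) := ![[0, 1], [2, 3], [0, 1, 3], [2]]

/-- The infinite fixed point B̄ of ψ starting with a: the n-th letter of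
ψ^k(a) for any k large enough (the word ψ^(n+1)(a) has length > n). -/
def Bbar (n : ℕ) : Fin 4 := ((fun w => w.flatMap psi)^[n + 1] [0]).getD n 0

/-- The k-th iterate of the substitution on the letter a. -/
def Wd (k : ℕ) : List (Fin 4) := (fun w => w.flatMap psi)^[k] [0]

theorem Wd_succ (k : ℕ) : Wd (k + 1) = (Wd k).flatMap psi := by
  unfold Wd
  rw [Function.iterate_succ_apply']

theorem flatMap_prefix {l l' : List (Fin 4)} (h : l <+: l') :
    l.flatMap psi <+: l'.flatMap psi := by
  obtain ⟨t, rfl⟩ := h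
  rw [List.flatMap_append]
  exact List.prefix_append _ _

theorem Wd_prefix_succ (k : ℕ) : Wd k <+: Wd (k + 1) := by
  induction k with
  | zero => exact ⟨[1], rfl⟩
  | succ k ih =>
    rw [Wd_succ k, Wd_succ (k + 1)]
    exact flatMap_prefix ih

theorem Wd_prefix {k l : ℕ} (h : k ≤ l) : Wd k <+: Wd l := by
  induction l, h using Nat.le_induction with
  | base => exact List.prefix_refl _
  | succ l _ ih => exact ih.trans (Wd_prefix_succ l)

theorem psi_length_pos (x : Fin 4) : 1 ≤ (psi x).length := by
  revert x; decide

theorem length_le_flatMap (l : List (Fin 4)) : l.length ≤ (l.flatMap psi).length := by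
  induction l with
  | nil => simp
  | cons x t ih =>
    have := psi_length_pos x
    simp only [List.flatMap_cons, List.length_append, List.length_cons]
    omega

theorem Wd_length (k : ℕ) : k + 1 ≤ (Wd k).length := by
  induction k with
  | zero => simp [Wd]
  | succ k ih =>
    obtain ⟨t, ht⟩ := Wd_prefix (Nat.zero_le k)
    have h0 : Wd 0 = [0] := rfl
    rw [h0] at ht
    rw [Wd_succ, ← ht]
    rw [← ht] at ih
    have := length_le_flatMap t
    have h2 : (psi 0).length = 2 := rfl
    simp only [List.flatMap_append, List.length_append, List.flatMap_cons, List.flatMap_nil,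
      List.length_cons, List.length_nil] at *
    omega

theorem Bbar_eq_Wd {k n : ℕ} (h : n < (Wd k).length) : Bbar n = (Wd k)[n] := by
  have h1 : n < (Wd (n + 1)).length := by have := Wd_length (n + 1); omega
  have h2 : Bbar n = (Wd (n + 1))[n] := by
    show (Wd (n + 1)).getD n 0 = _
    simp [h1]
  rw [h2]
  rcases le_total k (n + 1) with hk | hk
  · exact ((Wd_prefix hk).getElem h).symm
  · exact (Wd_prefix hk).getElem h1

/-- Prefix of length n of the fixed point. -/
def Pre (n : ℕ) : List (Fin 4) := (List.range n).map Bbar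

theorem Pre_prefix (n : ℕ) : Pre n <+: Wd n := by
  rw [List.prefix_iff_getElem]
  have := Wd_length n
  refine ⟨by simp [Pre]; omega, ?_⟩
  intro i hi
  simp only [Pre, List.getElem_map, List.getElem_range]
  exact Bbar_eq_Wd _

/-- Position where the image of the n-th letter starts. -/
def pos (n : ℕ) : ℕ := ((Pre n).flatMap psi).length

theorem Pre_succ (n : ℕ) : Pre (n + 1) = Pre n ++ [Bbar n] := by
  simp [Pre, List.range_succ]

theorem pos_succ (n : ℕ) : pos (n + 1) = pos n + (psi (Bbar n)).length := by
  simp [pos, Pre_succ]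

theorem Bbar_pos (n k : ℕ) (hk : k < (psi (Bbar n)).length) :
    Bbar (pos n + k) = (psi (Bbar n))[k] := by
  have h : (Pre (n + 1)).flatMap psi <+: Wd (n + 2) := by
    rw [Wd_succ]
    exact flatMap_prefix (Pre_prefix (n + 1))
  have hl : pos n + k < ((Pre (n + 1)).flatMap psi).length := by
    have := pos_succ n
    unfold pos at *
    omega
  have hl2 := lt_of_lt_of_le hl h.length_le
  rw [Bbar_eq_Wd hl2, ← h.getElem hl]
  simp [Pre_succ, pos]

theorem Bbar_zero : Bbar 0 = 0 := by rfl

theorem pos_zero : pos 0 = 0 := rfl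

/-- Description of the block over position n. -/
theorem block (n : ℕ) :
    (Bbar n = 0 ∧ pos (n + 1) = pos n + 2 ∧ Bbar (pos n) = 0 ∧ Bbar (pos n + 1) = 1) ∨
    (Bbar n = 1 ∧ pos (n + 1) = pos n + 2 ∧ Bbar (pos n) = 2 ∧ Bbar (pos n + 1) = 3) ∨
    (Bbar n = 2 ∧ pos (n + 1) = pos n + 3 ∧ Bbar (pos n) = 0 ∧ Bbar (pos n + 1) = 1 ∧
      Bbar (pos n + 2) = 3) ∨
    (Bbar n = 3 ∧ pos (n + 1) = pos n + 1 ∧ Bbar (pos n) = 2) := by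
  have h1 := pos_succ n
  have h2 := Bbar_pos n
  generalize Bbar n = x at h1 h2
  fin_cases x
  · left
    exact ⟨rfl, h1, h2 0 (by decide), h2 1 (by decide)⟩
  · right; left
    exact ⟨rfl, h1, h2 0 (by decide), h2 1 (by decide)⟩
  · right; right; left
    exact ⟨rfl, h1, h2 0 (by decide), h2 1 (by decide), h2 2 (by decide)⟩
  · right; right; right
    exact ⟨rfl, h1, h2 0 (by decide)⟩

theorem pos_strictMono : StrictMono pos :=
  strictMono_nat_of_lt_succ fun n => by
    have := psi_length_pos (Bbar n)
    rw [pos_succ]; omega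

/-- Every position lies in a block. -/
theorem exists_block (n : ℕ) : ∃ p, pos p ≤ n ∧ n < pos (p + 1) := by
  induction n with
  | zero => exact ⟨0, le_refl _, by rw [← pos_zero]; exact pos_strictMono (by omega)⟩
  | succ n ih =>
    obtain ⟨p, h1, h2⟩ := ih
    by_cases h : n + 1 < pos (p + 1)
    · exact ⟨p, by omega, h⟩
    · refine ⟨p + 1, by omega, ?_⟩
      have := pos_strictMono (show p + 1 < p + 1 + 1 by omega)
      omega

/-- A position carrying a or b is a block start. -/
theorem start_of (n : ℕ) (h : Bbar n = 0 ∨ Bbar n = 2) : ∃ p, pos p = n := by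
  obtain ⟨p, h1, h2⟩ := exists_block n
  refine ⟨p, ?_⟩
  by_contra hne
  have h3 : n = pos p + 1 ∨ n = pos p + 2 := by
    rcases block p with b | b | b | b <;> omega
  rcases h3 with rfl | rfl <;> rcases block p with b | b | b | b <;> omega

theorem start_letter (p : ℕ) : Bbar (pos p) = 0 ∨ Bbar (pos p) = 2 := by
  rcases block p with b | b | b | b <;> simp [b]

/-- Last letter of a block. -/
theorem last_letter (p : ℕ) : ∃ r, pos (p + 1) = r + 1 ∧
    ((Bbar p = 0 ∧ Bbar r = 1) ∨ (Bbar p = 1 ∧ Bbar r = 3) ∨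
      (Bbar p = 2 ∧ Bbar r = 3) ∨ (Bbar p = 3 ∧ Bbar r = 2)) := by
  rcases block p with b | b | b | b
  · exact ⟨pos p + 1, by omega, by simp [b]⟩
  · exact ⟨pos p + 1, by omega, by simp [b]⟩
  · exact ⟨pos p + 2, by omega, by simp [b]⟩
  · exact ⟨pos p, by omega, by simp [b]⟩

/-- The allowed pairs of consecutive letters. -/
def OkPair (x y : Fin 4) : Prop :=
  (x = 0 ∧ y = 1) ∨ (x = 1 ∧ y = 2) ∨ (x = 1 ∧ y = 3) ∨ (x = 2 ∧ y = 0) ∨ (x = 2 ∧ y = 3) ∨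
    (x = 3 ∧ y = 0) ∨ (x = 3 ∧ y = 2)

theorem succ_le_pos (p : ℕ) (hp : 1 ≤ p) : p + 1 ≤ pos p := by
  induction p, hp using Nat.le_induction with
  | base => exact le_refl 2
  | succ p _ ih =>
    have := pos_strictMono (show p < p + 1 by omega)
    omega

theorem pair (n : ℕ) : OkPair (Bbar n) (Bbar (n + 1)) := by
  induction n using Nat.strong_induction_on with
  | _ n ih =>
    obtain ⟨p, h1, h2⟩ := exists_block n
    by_cases h : n + 1 < pos (p + 1)
    · have h3 : n = pos p ∨ n = pos p + 1 := by
        rcases block p with b | b | b | b <;> omega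
      rcases h3 with rfl | rfl <;> rcases block p with b | b | b | b <;>
        first | omega | simp [OkPair, b]
    · have hn : n + 1 = pos (p + 1) := by omega
      rcases Nat.eq_zero_or_pos n with h0 | h0
      · subst h0
        left; exact ⟨rfl, rfl⟩
      have hp : p < n := by
        rcases Nat.eq_zero_or_pos p with hp | hp
        · omega
        · have h4 := succ_le_pos p hp
          omega
      have hpair := ih p hp
      obtain ⟨r, hr, hl⟩ := last_letter p
      have : r = n := by omega
      subst this
      rw [hn]
      have hb := block (p + 1)
      unfold OkPair at *
      generalize Bbar (pos (p + 1)) = y at *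
      generalize Bbar (p + 1) = z at *
      generalize Bbar p = x at *
      generalize Bbar r = u at *
      clear ih
      rcases hpair with h | h | h | h | h | h | h <;> obtain ⟨rfl, rfl⟩ := h <;> simp at hl hb <;>
        simp [hl, hb]

theorem triple (n : ℕ) (h : Bbar (n + 1) = 2) : Bbar n = 1 ↔ Bbar (n + 2) = 3 := by
  obtain ⟨p, hp⟩ := start_of (n + 1) (Or.inr h)
  obtain _ | q := p
  · rw [pos_zero] at hp; omega
  obtain ⟨r, hr, hl⟩ := last_letter q
  have : r = n := by omega
  subst this
  have hq := pair q
  have hs := start_letter (q + 1 + 1)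
  unfold OkPair at hq
  rcases block (q + 1) with b | b | b | b
  · rw [hp, h] at b; simp at b
  · have e : r + 2 = pos (q + 1) + 1 := by omega
    rw [e]
    simp [b] at hq
    simp [hq] at hl
    simp [hl, b]
  · rw [hp, h] at b; simp at b
  · have e : r + 2 = pos (q + 1 + 1) := by omega
    rw [e]
    simp [b] at hq
    have hr3 : Bbar r = 3 := by
      rcases hq with hq | hq <;> simp [hq] at hl <;> exact hl
    rcases hs with hs | hs <;> simp [hs, hr3]

/-- Comparison of two blocks that agree on their first letter. -/
theorem cmp_first (p q : ℕ) (h : Bbar (pos p) = Bbar (pos q)) :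
    ((Bbar p = 0 ∨ Bbar p = 2) ∧ (Bbar q = 0 ∨ Bbar q = 2)) ∨
    ((Bbar p = 1 ∨ Bbar p = 3) ∧ (Bbar q = 1 ∨ Bbar q = 3)) := by
  rcases block p with b | b | b | b <;> rcases block q with c | c | c | c <;>
    simp [b, c] at h <;> simp [b, c]

/-- Comparison of two blocks that agree on the whole of the first one. -/
theorem cmp_part (p q L : ℕ) (e : pos p + L = pos q)
    (h : ∀ n, pos p ≤ n → n < pos (p + 1) → Bbar n = Bbar (n + L)) :
    Bbar p = Bbar q ∨ (Bbar p = 0 ∧ Bbar q = 2) ∨ (Bbar p = 3 ∧ Bbar q = 1) := by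
  have h0 := h (pos p) (by omega) (pos_strictMono (by omega))
  rw [e] at h0
  have s2 := start_letter (q + 1)
  have e1 : pos p + 1 + L = pos q + 1 := by omega
  have e2 : pos p + 2 + L = pos q + 2 := by omega
  rcases cmp_first p q h0 with ⟨hp | hp, hq | hq⟩ | ⟨hp | hp, hq | hq⟩
  · simp [hp, hq]
  · simp [hp, hq]
  · exfalso
    have bp := block p
    have bq := block q
    simp [hp] at bp
    simp [hq] at bq
    have h2 := h (pos p + 2) (by omega) (by omega)
    rw [e2, bp.2.2.2, ← bq.1] at h2
    rw [← h2] at s2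
    simp at s2
  · simp [hp, hq]
  · simp [hp, hq]
  · exfalso
    have bp := block p
    have bq := block q
    simp [hp] at bp
    simp [hq] at bq
    have h2 := h (pos p + 1) (by omega) (by omega)
    rw [e1, bp.2.2, ← bq.1] at h2
    rw [← h2] at s2
    simp at s2
  · simp [hp, hq]
  · simp [hp, hq]

/-- Comparison of two blocks that agree up to and including the next start. -/
theorem cmp_full (p q L : ℕ) (e : pos p + L = pos q)
    (h : ∀ n, pos p ≤ n → n ≤ pos (p + 1) → Bbar n = Bbar (n + L)) :
    Bbar p = Bbar q ∧ pos (p + 1) + L = pos (q + 1) := by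
  have h1 := cmp_part p q L e (fun n a b => h n a (by omega))
  have h3 := h (pos (p + 1)) (pos_strictMono.monotone (by omega)) (by omega)
  have s1 := start_letter (p + 1)
  rcases h1 with h1 | ⟨hp, hq⟩ | ⟨hp, hq⟩
  · refine ⟨h1, ?_⟩
    rw [pos_succ, pos_succ, h1]
    omega
  all_goals
    exfalso
    have bp := block p
    have bq := block q
    simp [hp] at bp
    simp [hq] at bq
    rw [h3] at s1
  · have e2 : pos (p + 1) + L = pos q + 2 := by omega
    rw [e2, bq.2.2.2] at s1
    simp at s1
  · have e2 : pos (p + 1) + L = pos q + 1 := by omega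
    rw [e2, bq.2.2] at s1
    simp at s1

/-- The letters 1 and 3 cannot follow the same letter. -/
theorem no_common_pred (n k : ℕ) (h : Bbar n = Bbar k) (h1 : Bbar (n + 1) = 1)
    (h2 : Bbar (k + 1) = 3) : False := by
  have a := pair n
  have b := pair k
  unfold OkPair at a b
  rw [h1] at a
  rw [h2] at b
  rw [h] at a
  simp at a b
  rw [a] at b
  simp at b

theorem adj_ne (n : ℕ) : Bbar n ≠ Bbar (n + 1) := by
  intro h
  have a := pair n
  rw [← h] at a
  unfold OkPair at a
  generalize Bbar n = x at a
  revert a; revert x; decide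

/-- Among three consecutive positions one is a block start; take the first one. -/
theorem first_start (i : ℕ) : ∃ p, i ≤ pos p ∧ pos p ≤ i + 2 ∧
    ∀ r, i ≤ pos r → pos p ≤ pos r := by
  obtain ⟨q, h1, h2⟩ := exists_block i
  rcases Nat.eq_or_lt_of_le h1 with h | h
  · exact ⟨q, by omega, by omega, fun r hr => by omega⟩
  · refine ⟨q + 1, by omega, ?_, fun r hr => ?_⟩
    · rcases block q with b | b | b | b <;> omega
    · have : q < r := by
        rw [← pos_strictMono.lt_iff_lt]; omega
      exact pos_strictMono.monotone this

theorem pos_add_le (p t : ℕ) : pos p + t ≤ pos (p + t) := by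
  induction t with
  | zero => exact le_refl _
  | succ t ih =>
    have : pos (p + t) < pos (p + (t + 1)) := pos_strictMono (by omega)
    omega

/-- Squares go down: combinatorial core. -/
theorem core (i L : ℕ) (hL : 2 ≤ L) (hsq : ∀ n, i ≤ n → n < i + L → Bbar n = Bbar (n + L)) :
    ∃ j m, 1 ≤ m ∧ m < L ∧ ∀ n, j ≤ n → n < j + m → Bbar n = Bbar (n + m) := by
  obtain ⟨p, hp1, hp2, hmin⟩ := first_start i
  have hstart : ∀ n, i ≤ n → n < i + L → (Bbar (n + L) = 0 ∨ Bbar (n + L) = 2) → pos p ≤ n := by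
    intro n h1 h2 h3
    rw [← hsq n h1 h2] at h3
    obtain ⟨r, hr⟩ := start_of n h3
    have := hmin r (by omega)
    omega
  have hpL : pos p < i + L := by
    by_contra hc
    have h1 : pos p = i + L := by omega
    have := hstart i (le_refl _) (by omega) (by rw [← h1]; exact start_letter p)
    omega
  obtain ⟨q, hq⟩ : ∃ q, pos q = pos p + L := by
    apply start_of
    rw [← hsq _ hp1 hpL]
    exact start_letter p
  obtain ⟨m, rfl⟩ : ∃ m, q = p + m + 1 := by
    have : p < q := by rw [← pos_strictMono.lt_iff_lt]; omega
    exact ⟨q - p - 1, by omega⟩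
  have hlast : pos (p + m) < i + L := by
    by_contra hc
    have h1 : pos (p + m) < pos (p + m + 1) := pos_strictMono (by omega)
    have h2 := hstart (pos (p + m) - L) (by omega) (by omega)
      (by rw [Nat.sub_add_cancel (by omega)]; exact start_letter _)
    omega
  have hpos : ∀ t, t ≤ m → pos (p + t) + L = pos (p + m + 1 + t) := by
    intro t
    induction t with
    | zero => intro _; exact hq.symm
    | succ t ih =>
      intro ht
      have hle : pos (p + t + 1) ≤ pos (p + m) := pos_strictMono.monotone (by omega)
      have hge : pos p ≤ pos (p + t) := pos_strictMono.monotone (by omega)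
      exact (cmp_full (p + t) (p + m + 1 + t) L (ih (by omega))
        (fun n a b => hsq n (by omega) (by omega))).2
  have heq : ∀ t, t < m → Bbar (p + t) = Bbar (p + m + 1 + t) := by
    intro t ht
    have hle : pos (p + t + 1) ≤ pos (p + m) := pos_strictMono.monotone (by omega)
    have hge : pos p ≤ pos (p + t) := pos_strictMono.monotone (by omega)
    exact (cmp_full (p + t) (p + m + 1 + t) L (hpos t (by omega))
        (fun n a b => hsq n (by omega) (by omega))).1
  -- size of the desubstituted square
  have hsize : m + 1 < L ∨ ∀ x, p ≤ x → x ≤ p + m → Bbar x = 3 := by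
    by_contra hc
    push Not at hc
    obtain ⟨hc1, x, hx1, hx2, hx3⟩ := hc
    have k1 := pos_add_le p (x - p)
    have k2 := pos_add_le (x + 1) (p + m - x)
    have e1 : p + (x - p) = x := by omega
    have e2 : x + 1 + (p + m - x) = p + m + 1 := by omega
    rw [e1] at k1
    rw [e2] at k2
    have : pos x + 2 ≤ pos (x + 1) := by
      rcases block x with b | b | b | b
      · omega
      · omega
      · omega
      · exact absurd b.1 hx3
    omega
  have hm : m + 1 < L := by
    rcases hsize with h | h
    · exact h
    · rcases Nat.eq_zero_or_pos m with h0 | h0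
      · omega
      · exfalso
        apply adj_ne p
        rw [h p (by omega) (by omega), h (p + 1) (by omega) (by omega)]
  -- right extension
  by_cases hr : Bbar (p + m) = Bbar (p + m + 1 + m)
  · refine ⟨p, m + 1, by omega, hm, ?_⟩
    intro n h1 h2
    obtain ⟨t, rfl⟩ := Nat.exists_eq_add_of_le h1
    have e : p + t + (m + 1) = p + m + 1 + t := by omega
    rw [e]
    rcases Nat.lt_or_ge t m with h | h
    · exact heq t h
    · have : t = m := by omega
      subst this
      exact hr
  -- left extension
  by_cases hl : ∃ y, p = y + 1 ∧ Bbar y = Bbar (p + m)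
  · obtain ⟨y, hy, hy2⟩ := hl
    refine ⟨y, m + 1, by omega, hm, ?_⟩
    intro n h1 h2
    rcases Nat.eq_or_lt_of_le h1 with h | h
    · subst h
      rw [hy2]
      congr 1; omega
    · obtain ⟨t, rfl⟩ := Nat.exists_eq_add_of_le (show p ≤ n by omega)
      have e : p + t + (m + 1) = p + m + 1 + t := by omega
      rw [e]
      exact heq t (by omega)
  exfalso
  have hge : pos p ≤ pos (p + m) := pos_strictMono.monotone (by omega)
  have hposm := hpos m (le_refl _)
  -- the letters 1 and 3 at the two ends are impossible
  have bad : ∀ u v, ((u = p + m ∧ v = p + m + 1 + m) ∨ (v = p + m ∧ u = p + m + 1 + m)) →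
      Bbar u = 1 → Bbar v = 3 → 1 ≤ m → False := by
    intro u v huv hu hv h0
    have hh := heq (m - 1) (by omega)
    have e1 : p + m = p + (m - 1) + 1 := by omega
    have e2 : p + m + 1 + m = p + m + 1 + (m - 1) + 1 := by omega
    rcases huv with ⟨rfl, rfl⟩ | ⟨rfl, rfl⟩
    · rw [e1] at hu; rw [e2] at hv
      exact no_common_pred _ _ hh hu hv
    · rw [e1] at hv; rw [e2] at hu
      exact no_common_pred _ _ hh.symm hu hv
  rcases Nat.eq_or_lt_of_le hp1 with hi | hi
  · -- the square starts at a block start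
    rcases cmp_part (p + m) (p + m + 1 + m) L hposm
        (fun n a b => hsq n (by omega) (by omega)) with h | ⟨h1, h2⟩ | ⟨h1, h2⟩
    · exact hr h
    · rcases Nat.eq_zero_or_pos m with h0 | h0
      · subst h0
        have := pair p
        simp only [Nat.add_zero] at h1 h2
        simp [OkPair, h1, h2] at this
      · have a := pair (p + m)
        have hh := heq 0 h0
        simp only [Nat.add_zero] at hh
        simp [OkPair, h1] at a
        rw [a] at hh
        obtain _ | y := p
        · rw [Bbar_zero] at hh; simp at hh
        · have b := pair y
          simp [OkPair, hh] at b
          exact hl ⟨y, rfl, by rw [b, h1]⟩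
    · rcases Nat.eq_zero_or_pos m with h0 | h0
      · subst h0
        have := pair p
        simp only [Nat.add_zero] at h1 h2
        simp [OkPair, h1, h2] at this
      · exact bad (p + m + 1 + m) (p + m) (Or.inr ⟨rfl, rfl⟩) h2 h1 h0
  · -- the square starts inside a block
    obtain _ | y := p
    · rw [pos_zero] at hi; omega
    obtain ⟨r, hr1, hr2⟩ := last_letter y
    obtain ⟨s, hs1, hs2⟩ := last_letter (y + 1 + m)
    have hsr : s = r + L := by omega
    have hne : Bbar y ≠ Bbar (y + 1 + m) := fun h => hl ⟨y, rfl, h⟩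
    have hrs := hsq r (by omega) (by omega)
    rw [← hsr] at hrs
    have hfirst := hsq (pos (y + 1 + m)) (by omega) hlast
    rw [hposm] at hfirst
    have hcf := cmp_first _ _ hfirst
    rw [← hrs] at hs2
    have hcase : (Bbar y = 1 ∧ Bbar (y + 1 + m) = 2) ∨ (Bbar y = 2 ∧ Bbar (y + 1 + m) = 1) := by
      rcases hr2 with h | h | h | h <;> rcases hs2 with g | g | g | g <;>
        simp [h] at g <;> simp [h, g] at hne ⊢
    rcases hcase with ⟨h1, h2⟩ | ⟨h1, h2⟩
    · have h3 : Bbar (y + 1 + m + 1 + m) = 0 := by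
        simp [h2] at hcf hr
        rcases hcf with h | h
        · exact h
        · exact absurd h.symm hr
      rcases Nat.eq_zero_or_pos m with h0 | h0
      · subst h0
        have := (triple y h2).1 h1
        simp only [Nat.add_zero] at h3
        rw [h3] at this
        simp at this
      · have hh0 := heq 0 h0
        have hhm := heq (m - 1) (by omega)
        simp only [Nat.add_zero] at hh0
        have p1 := pair y
        have p2 := pair (y + 1 + m)
        have p3 := pair (y + 1 + (m - 1))
        have p4 := pair (y + 1 + m + 1 + (m - 1))
        have e1 : y + 1 + (m - 1) + 1 = y + 1 + m := by omega
        have e2 : y + 1 + m + 1 + (m - 1) + 1 = y + 1 + m + 1 + m := by omega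
        rw [e1] at p3
        rw [e2] at p4
        have c1 : Bbar (y + 1 + m + 1) = 3 := by
          rw [hh0] at p1
          simp [OkPair, h1, h2] at p1 p2
          rcases p1 with h | h <;> simp [h] at p2 ⊢
        have c2 : Bbar (y + 1 + (m - 1)) = 3 := by
          rw [← hhm] at p4
          simp [OkPair, h2, h3] at p3 p4
          rcases p3 with h | h <;> simp [h] at p4 ⊢
        have tr := triple (y + 1 + (m - 1)) (by rw [e1]; exact h2)
        have e3 : y + 1 + (m - 1) + 2 = y + 1 + m + 1 := by omega
        rw [e3] at tr
        simp [c1, c2] at tr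
    · have h3 : Bbar (y + 1 + m + 1 + m) = 3 := by
        simp [h2] at hcf hr
        rcases hcf with h | h
        · exact absurd h.symm hr
        · exact h
      rcases Nat.eq_zero_or_pos m with h0 | h0
      · subst h0
        have := pair y
        simp only [Nat.add_zero] at h2
        simp [OkPair, h1, h2] at this
      · exact bad _ _ (Or.inl ⟨rfl, rfl⟩) h2 h3 h0

theorem no_square (L : ℕ) : ∀ i, 1 ≤ L →
    ¬ ∀ n, i ≤ n → n < i + L → Bbar n = Bbar (n + L) := by
  induction L using Nat.strong_induction_on with
  | _ L ih =>
    intro i hL hsq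
    rcases Nat.eq_or_lt_of_le hL with h | h
    · subst h
      exact adj_ne i (hsq i (by omega) (by omega))
    · obtain ⟨j, m, h1, h2, h3⟩ := core i L h hsq
      exact ih m h2 j h1 h3

theorem Bbar_squarefree :
    ∀ i L : ℕ, 1 ≤ L → ∃ s < L, Bbar (i + s) ≠ Bbar (i + L + s) := by
  intro i L hL
  by_contra hc
  push Not at hc
  apply no_square L i hL
  intro n h1 h2
  obtain ⟨s, rfl⟩ := Nat.exists_eq_add_of_le h1
  rw [hc s (by omega)]
  congr 1; omega
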